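/- For every finite simple graph G and every vertex v, the number of simple paths of length 3 having v as an endpoint satisfies p₃(v) = Σ_{u : u adjacent to v} p₂(u) − deg(v)·(deg(v) − 1) − 2·t(v). -/

import Mathlib

open Finset Matrix SimpleGraph

variable {V : Type*} [Fintype V] [DecidableEq V]

/-- The number of simple paths (walks with no repeated vertices) of length `ℓ`
from `i` to `j` in `G` (`P_ℓ(i,j)`). -/
def pathCount (G : SimpleGraph V) [DecidableRel G.Adj] (ℓ : ℕ) (i j : V) : ℕ :=
  ((G.finsetWalkLength ℓ i j).filter fun w => w.IsPath).card

/-- The number of simple paths of length `ℓ` having `v` as an endpoint (`p_ℓ(v)`). -/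
def pathEndCount (G : SimpleGraph V) [DecidableRel G.Adj] (ℓ : ℕ) (v : V) : ℕ :=
  ∑ j, pathCount G ℓ v j

/-- The number of triangles (3-cliques) of `G` containing the vertex `v` (`t(v)`). -/
def triCount (G : SimpleGraph V) [DecidableRel G.Adj] (v : V) : ℕ :=
  ((G.cliqueFinset 3).filter fun s => v ∈ s).card

/-- The number of triangles (3-cliques) of `G` containing both `i` and `j` (`C₃(i,j)`). -/
def triPairCount (G : SimpleGraph V) [DecidableRel G.Adj] (i j : V) : ℕ :=
  ((G.cliqueFinset 3).filter fun s => i ∈ s ∧ j ∈ s).card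

open scoped Classical in
/-- The number of cycle subgraphs of length `ℓ` of `G` passing through vertex `i`:
each (unoriented) cycle subgraph through `i` corresponds to exactly two closed walks
of length `ℓ` based at `i` that are cycles (one for each direction of traversal). -/
noncomputable def cycleVertexCount (G : SimpleGraph V) [DecidableRel G.Adj] (ℓ : ℕ) (i : V) : ℕ :=
  ((G.finsetWalkLength ℓ i i).filter fun w => w.IsCycle).card / 2

open scoped Classical in
/-- The number of cycle subgraphs of length `ℓ` of `G` containing the edge `{i, j}`:
each such (unoriented) cycle subgraph corresponds to exactly one closed walk of
length `ℓ` based at `i` that is a cycle and whose first step goes to `j`. -/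
noncomputable def cycleEdgeCount (G : SimpleGraph V) [DecidableRel G.Adj] (ℓ : ℕ) (i j : V) : ℕ :=
  ((G.finsetWalkLength ℓ i i).filter fun w => w.IsCycle ∧ w.getVert 1 = j).card

open scoped Classical in
/-- The number of 4-cycle subgraphs of `G` in which `i` and `j` occupy diametrically
opposite positions: each such (unoriented) cycle subgraph corresponds to exactly two
closed walks of length 4 based at `i` that are cycles with `j` as the second vertex. -/
noncomputable def cycleOppCount (G : SimpleGraph V) [DecidableRel G.Adj] (i j : V) : ℕ :=
  ((G.finsetWalkLength 4 i i).filter fun w => w.IsCycle ∧ w.getVert 2 = j).card / 2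

/-- The number of 4-cliques of `G` containing the vertex `i`. -/
def k4Count (G : SimpleGraph V) [DecidableRel G.Adj] (i : V) : ℕ :=
  ((G.cliqueFinset 4).filter fun s => i ∈ s).card

/-- The number of 4-cliques of `G` containing both `i` and `j`. -/
def k4PairCount (G : SimpleGraph V) [DecidableRel G.Adj] (i j : V) : ℕ :=
  ((G.cliqueFinset 4).filter fun s => i ∈ s ∧ j ∈ s).card

/-- The number of simple paths of length `ℓ` from `i` to `j` in `G` avoiding `A`. -/
def pathCountAvoiding (G : SimpleGraph V) [DecidableRel G.Adj] (ℓ : ℕ) (i j : V)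
    (A : Finset V) : ℕ :=
  ((G.finsetWalkLength ℓ i j).filter fun w => w.IsPath ∧ ∀ x ∈ w.support, x ∉ A).card

/-- The number of simple paths of length `ℓ` in `G` starting at `i` and avoiding `A`. -/
def pathEndCountAvoiding (G : SimpleGraph V) [DecidableRel G.Adj] (ℓ : ℕ) (i : V)
    (A : Finset V) : ℕ :=
  ∑ j, pathCountAvoiding G ℓ i j A

lemma pathEndCount_eq_avoiding_empty (G : SimpleGraph V) [DecidableRel G.Adj] (ℓ : ℕ) (i : V) :
    pathEndCount G ℓ i = pathEndCountAvoiding G ℓ i ∅ := by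
  simp [pathEndCount, pathEndCountAvoiding, pathCount, pathCountAvoiding]

lemma pathEndCountAvoiding_zero (G : SimpleGraph V) [DecidableRel G.Adj] (i : V)
    (A : Finset V) : pathEndCountAvoiding G 0 i A = if i ∈ A then 0 else 1 := by
  unfold pathEndCountAvoiding
  rw [Finset.sum_eq_single i]
  · split_ifs with h <;>
      simp [pathCountAvoiding, finsetWalkLength, Finset.filter_singleton, h]
  · intro j _ hj
    simp [pathCountAvoiding, finsetWalkLength, hj.symm]
  · simp

lemma pathCountAvoiding_succ (G : SimpleGraph V) [DecidableRel G.Adj] (ℓ : ℕ) (i j : V)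
    (A : Finset V) : pathCountAvoiding G (ℓ + 1) i j A =
      if i ∈ A then 0 else ∑ w ∈ G.neighborFinset i, pathCountAvoiding G ℓ w j (insert i A) := by
  unfold pathCountAvoiding
  split_ifs with h
  · rw [Finset.card_eq_zero, Finset.filter_eq_empty_iff]
    exact fun w _ hw => hw.2 i w.start_mem_support h
  · rw [finsetWalkLength, Finset.filter_biUnion, Finset.card_biUnion]
    · rw [Finset.sum_subtype (G.neighborFinset i) (p := (· ∈ G.neighborSet i)) (by simp)]
      refine Finset.sum_congr rfl fun w _ => ?_
      rw [Finset.filter_map, Finset.card_map]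
      refine congrArg _ (Finset.filter_congr fun p _ => ?_)
      have hw : G.Adj i w := w.property
      change (Walk.cons hw p).IsPath ∧ (∀ x ∈ (Walk.cons hw p).support, x ∉ A) ↔ _
      simp only [Walk.cons_isPath_iff, Walk.support_cons, List.mem_cons, forall_eq_or_imp,
        Finset.mem_insert, not_or, h, not_false_eq_true, true_and]
      exact ⟨fun hp => ⟨hp.1.1, fun x hx => ⟨fun e => hp.1.2 (e ▸ hx), hp.2 x hx⟩⟩,
        fun hp => ⟨⟨hp.1, fun hi => (hp.2 i hi).1 rfl⟩, fun x hx => (hp.2 x hx).2⟩⟩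
    · intro x _ y _ hxy
      rw [Function.onFun, Finset.disjoint_left]
      intro p hp hq
      simp only [Finset.mem_filter, Finset.mem_map] at hp hq
      obtain ⟨⟨p, _, rfl⟩, _⟩ := hp
      obtain ⟨⟨q, _, hq⟩, _⟩ := hq
      exact hxy (Subtype.ext (Walk.cons.inj hq).1.symm)

lemma pathEndCountAvoiding_succ (G : SimpleGraph V) [DecidableRel G.Adj] (ℓ : ℕ) (i : V)
    (A : Finset V) : pathEndCountAvoiding G (ℓ + 1) i A =
      if i ∈ A then 0 else ∑ w ∈ G.neighborFinset i, pathEndCountAvoiding G ℓ w (insert i A) := by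
  simp only [pathEndCountAvoiding, pathCountAvoiding_succ]
  split_ifs
  · simp
  · exact Finset.sum_comm

lemma card_triangles_through_edge (G : SimpleGraph V) [DecidableRel G.Adj] {u v : V}
    (h : G.Adj v u) :
    (((G.cliqueFinset 3).filter fun s => v ∈ s).filter fun s => u ∈ s).card =
      (G.neighborFinset u ∩ G.neighborFinset v).card := by
  symm
  refine Finset.card_nbij (fun a => {v, u, a}) ?_ ?_ ?_
  · intro a ha
    rw [Finset.mem_coe, Finset.mem_inter, mem_neighborFinset, mem_neighborFinset] at ha
    simp [is3Clique_triple_iff, h, ha]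
  · intro a ha b hb hab
    rw [Finset.mem_coe, Finset.mem_inter, mem_neighborFinset, mem_neighborFinset] at ha
    have : a ∈ ({v, u, b} : Finset V) := by
      have hab : ({v, u, a} : Finset V) = {v, u, b} := hab
      rw [← hab]; simp
    simp only [Finset.mem_insert, Finset.mem_singleton] at this
    obtain rfl | rfl | rfl := this
    · exact (G.irrefl ha.2).elim
    · exact (G.irrefl ha.1).elim
    · rfl
  · intro s hs
    simp only [Finset.coe_filter, Finset.mem_filter, mem_cliqueFinset_iff,
      Set.mem_ofPred_eq] at hs
    obtain ⟨⟨hs, hv⟩, hu⟩ := hs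
    have hcard : ((s.erase v).erase u).card = 1 := by
      rw [Finset.card_erase_of_mem (by simp [hu, h.ne']), Finset.card_erase_of_mem hv,
        hs.card_eq]
    obtain ⟨a, ha⟩ := Finset.card_eq_one.mp hcard
    have has : a ∈ (s.erase v).erase u := by simp [ha]
    simp only [Finset.mem_erase] at has
    refine ⟨a, ?_, ?_⟩
    · simp [hs.isClique hu has.2.2 (Ne.symm has.1), hs.isClique hv has.2.2 (Ne.symm has.2.1)]
    · change {v, u, a} = s
      rw [← ha, Finset.insert_erase (by simp [hu, h.ne']), Finset.insert_erase hv]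

lemma sum_card_common_neighbors (G : SimpleGraph V) [DecidableRel G.Adj] (v : V) :
    ∑ u ∈ G.neighborFinset v, (G.neighborFinset u ∩ G.neighborFinset v).card =
      2 * triCount G v := by
  calc
    _ = ∑ u ∈ G.neighborFinset v,
        (((G.cliqueFinset 3).filter fun s => v ∈ s).filter fun s => u ∈ s).card :=
      Finset.sum_congr rfl fun u hu =>
        (card_triangles_through_edge G ((G.mem_neighborFinset v u).mp hu)).symm
    _ = ∑ s ∈ (G.cliqueFinset 3).filter fun s => v ∈ s,
        ((G.neighborFinset v).filter fun u => u ∈ s).card :=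
      Finset.sum_card_bipartiteAbove_eq_sum_card_bipartiteBelow (fun u s => u ∈ s)
    _ = ∑ s ∈ (G.cliqueFinset 3).filter fun s => v ∈ s, 2 := by
      refine Finset.sum_congr rfl fun s hs => ?_
      simp only [Finset.mem_filter, mem_cliqueFinset_iff] at hs
      have : (G.neighborFinset v).filter (fun u => u ∈ s) = s.erase v := by
        ext u
        simp only [Finset.mem_filter, mem_neighborFinset, Finset.mem_erase]
        exact ⟨fun h => ⟨h.1.ne', h.2⟩, fun h => ⟨hs.1.isClique hs.2 h.2 h.1.symm, h.2⟩⟩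
      rw [this, Finset.card_erase_of_mem hs.2, hs.1.card_eq]
    _ = 2 * triCount G v := by simp [triCount, mul_comm]

lemma pathEndCountAvoiding_one (G : SimpleGraph V) [DecidableRel G.Adj] (a : V)
    (A : Finset V) :
    pathEndCountAvoiding G 1 a A = if a ∈ A then 0 else (G.neighborFinset a \ A).card := by
  rw [pathEndCountAvoiding_succ G 0]
  simp only [pathEndCountAvoiding_zero]
  congr 1
  rw [Finset.card_eq_sum_ones, ← Finset.filter_notMem_eq_sdiff, Finset.sum_filter]
  refine Finset.sum_congr rfl fun b hb => ?_
  have : b ≠ a := ((G.mem_neighborFinset a b).mp hb).ne'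
  by_cases hbA : b ∈ A <;> simp [this, hbA]

/-- Extending back along an edge `v u`, the paths of length 2 from `u` that meet `v` either
start with `v` or close up a triangle. -/
lemma pathEndCount_two_eq (G : SimpleGraph V) [DecidableRel G.Adj] {u v : V}
    (h : G.Adj v u) :
    (pathEndCount G 2 u : ℤ) = pathEndCountAvoiding G 2 u {v} + ((G.degree v : ℤ) - 1)
      + (G.neighborFinset u ∩ G.neighborFinset v).card := by
  have term (a : V) (ha : a ∈ G.neighborFinset u) :
      (pathEndCountAvoiding G 1 a {u} : ℤ) = pathEndCountAvoiding G 1 a {u, v}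
        + (if a = v then (G.degree v : ℤ) - 1 else 0)
        + (if a ∈ G.neighborFinset v then 1 else 0) := by
    rw [mem_neighborFinset] at ha
    have hu : u ∈ G.neighborFinset a := by simpa using ha.symm
    have hsub : ((G.neighborFinset a \ {u}).card : ℤ) = G.degree a - 1 := by
      rw [Finset.sdiff_singleton_eq_erase, Finset.cast_card_erase_of_mem hu,
        card_neighborFinset_eq_degree]
    simp only [pathEndCountAvoiding_one, Finset.mem_insert, Finset.mem_singleton, ha.ne', if_false,
      false_or]
    by_cases hav : a = v
    · subst hav
      simp [hsub]
    · have hsd : G.neighborFinset a \ {u, v} = (G.neighborFinset a \ {u}).erase v := by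
        ext; simp; tauto
      simp only [hav, if_false, hsd]
      by_cases hv : G.Adj v a
      · rw [Finset.cast_card_erase_of_mem (by simp [hv.symm, h.ne])]
        simp [hv]
      · rw [Finset.erase_eq_of_notMem (by simp [G.adj_comm a v, hv])]
        simp [hv]
  have hv : v ∈ G.neighborFinset u := by simpa using h.symm
  rw [pathEndCount_eq_avoiding_empty, pathEndCountAvoiding_succ G 1, pathEndCountAvoiding_succ G 1]
  simp only [Finset.notMem_empty, Finset.mem_singleton, h.ne', if_false, insert_empty_eq]
  push_cast
  rw [Finset.sum_congr rfl term, Finset.sum_add_distrib, Finset.sum_add_distrib,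
    Finset.sum_ite_eq' _ v, if_pos hv, Finset.sum_boole, Finset.filter_mem_eq_inter]

/-- For every vertex `v`, the number of simple paths of length 3 with
`v` as an endpoint satisfies `p₃(v) = Σ_{u ~ v} p₂(u) − deg(v)·(deg(v) − 1) − 2·t(v)`. -/
theorem stmt9 (G : SimpleGraph V) [DecidableRel G.Adj] (v : V) :
    (pathEndCount G 3 v : ℤ) =
      (∑ u ∈ G.neighborFinset v, (pathEndCount G 2 u : ℤ))
        - (G.degree v : ℤ) * ((G.degree v : ℤ) - 1) - 2 * (triCount G v : ℤ) := by
  have key : pathEndCount G 3 v = ∑ u ∈ G.neighborFinset v, pathEndCountAvoiding G 2 u {v} := by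
    simp [pathEndCount_eq_avoiding_empty, pathEndCountAvoiding_succ G 2]
  have tri := congrArg (Nat.cast : ℕ → ℤ) (sum_card_common_neighbors G v)
  push_cast at tri
  rw [key, ← tri, Finset.sum_congr rfl fun u hu =>
    pathEndCount_two_eq G ((G.mem_neighborFinset v u).mp hu)]
  simp only [Finset.sum_add_distrib, Finset.sum_const, card_neighborFinset_eq_degree, nsmul_eq_mul]
  push_cast
  ring
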